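/- Fix β ≥ 0 and n ≥ 1. For 1 ≤ i,j ≤ n let ε_{ij} := 1 if j > i, −1 if j < i, and 0 if i = j, and for v = ((x₁,y₁,z₁),…,(xₙ,yₙ,zₙ)) ∈ (ℝ³)^n set X_{n,i}(v) := −n^{−1/2} Σ_{j=1}^n ε_{ij} x_j and Y_{n,i}(v) := −n^{−1/2} Σ_{j=1}^n ε_{ij} y_j. Then for every Schwartz function f : ℝ³ → ℝ, Ent_{ν_n^β}(f²) ≤ (2/n) Σ_{i=1}^n ∫_{(ℝ³)^n} h( s_n^β(v), X_{n,i}(v), Y_{n,i}(v) ) dN(0,I_{3n})(v), where for (x,y,z) ∈ ℝ³ and (x',y') ∈ ℝ², h(x,y,z,x',y') := (∂_x f(x,y,z) − (y'/2) ∂_z f(x,y,z))² + (∂_y f(x,y,z) + (x'/2) ∂_z f(x,y,z))² + β² (∂_z f(x,y,z))². -/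

import Mathlib

open MeasureTheory ProbabilityTheory

noncomputable section

/-- The Heisenberg group as ℝ³. -/
abbrev H : Type := ℝ × ℝ × ℝ

/-- Entropy of `f` with respect to `μ`. -/
def Ent {α : Type*} [MeasurableSpace α] (μ : Measure α) (f : α → ℝ) : ℝ :=
  ∫ a, f a * Real.log (f a) ∂μ - (∫ a, f a ∂μ) * Real.log (∫ a, f a ∂μ)

/-- Partial derivative in the first coordinate. -/
def pdx (f : H → ℝ) (p : H) : ℝ := deriv (fun t => f (t, p.2.1, p.2.2)) p.1

/-- Partial derivative in the second coordinate. -/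
def pdy (f : H → ℝ) (p : H) : ℝ := deriv (fun t => f (p.1, t, p.2.2)) p.2.1

/-- Partial derivative in the third coordinate. -/
def pdz (f : H → ℝ) (p : H) : ℝ := deriv (fun t => f (p.1, p.2.1, t)) p.2.2

/-- The standard Gaussian measure on ℝ³. -/
def stdGauss3 : Measure H :=
  (gaussianReal 0 1).prod ((gaussianReal 0 1).prod (gaussianReal 0 1))

/-- The standard Gaussian measure N(0, I_{3n}) on (ℝ³)^n. -/
def gaussN (n : ℕ) : Measure (Fin n → H) := Measure.pi fun _ => stdGauss3

/-- `s_{n,k}^β` : the `k`-th step of the Heisenberg random walk built from `n` increments. -/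
def snk (β : ℝ) (n k : ℕ) (v : Fin n → H) : H :=
  ((n : ℝ) ^ (-(1:ℝ)/2) * ∑ i : Fin n, (if i.val < k then (v i).1 else 0),
   (n : ℝ) ^ (-(1:ℝ)/2) * ∑ i : Fin n, (if i.val < k then (v i).2.1 else 0),
   β * (n : ℝ) ^ (-(1:ℝ)/2) * ∑ i : Fin n, (if i.val < k then (v i).2.2 else 0)
     + (2 * (n : ℝ))⁻¹ * ∑ i : Fin n, ∑ j : Fin n,
        (if i.val < j.val ∧ j.val < k then
          (v i).1 * (v j).2.1 - (v i).2.1 * (v j).1 else 0))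

/-- `ν_n^β` : the law of the Heisenberg random walk at its `n`-th step. -/
def nuMeas (β : ℝ) (n : ℕ) : Measure H := (gaussN n).map (snk β n n)

/-- The antisymmetric sign `ε_{ij}`. -/
def eps {n : ℕ} (i j : Fin n) : ℝ := if i < j then 1 else if j < i then -1 else 0

/-- `X_{n,i}`. -/
def Xni (n : ℕ) (i : Fin n) (v : Fin n → H) : ℝ :=
  -((n : ℝ) ^ (-(1:ℝ)/2)) * ∑ j : Fin n, eps i j * (v j).1

/-- `Y_{n,i}`. -/
def Yni (n : ℕ) (i : Fin n) (v : Fin n → H) : ℝ :=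
  -((n : ℝ) ^ (-(1:ℝ)/2)) * ∑ j : Fin n, eps i j * (v j).2.1

/-- The function `h(x,y,z,x',y')`. -/
def hfun (β : ℝ) (f : H → ℝ) (p : H) (w : ℝ × ℝ) : ℝ :=
  (pdx f p - w.2 / 2 * pdz f p) ^ 2 + (pdy f p + w.1 / 2 * pdz f p) ^ 2
    + β ^ 2 * (pdz f p) ^ 2

open Set Filter Topology

/-- The distribution function of a continuous integrable density is a primitive of it. -/
lemma hasStrictDerivAt_integral_Iic {p : ℝ → ℝ} (hp : Continuous p) (hi : Integrable p) (x : ℝ) :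
    HasStrictDerivAt (fun y => ∫ t in Iic y, p t) (p x) x := by
  have h : (fun y => ∫ t in Iic y, p t)
      = fun y => (∫ t in Iic 0, p t) + ∫ t in (0 : ℝ)..y, p t := by
    funext y
    rw [← intervalIntegral.integral_Iic_sub_Iic hi.integrableOn hi.integrableOn]
    ring
  rw [h]
  exact (hp.integral_hasStrictDerivAt 0 x).const_add _

lemma strictMono_integral_Iic {p : ℝ → ℝ} (hp : Continuous p) (hi : Integrable p)
    (h0 : ∀ x, 0 < p x) : StrictMono fun y => ∫ t in Iic y, p t := by
  refine strictMono_of_deriv_pos fun x => ?_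
  rw [(hasStrictDerivAt_integral_Iic hp hi x).hasDerivAt.deriv]
  exact h0 x

lemma range_integral_Iic {p : ℝ → ℝ} (hp : Continuous p) (hi : Integrable p)
    (h0 : ∀ x, 0 < p x) (h1 : ∫ x, p x = 1) :
    range (fun y => ∫ t in Iic y, p t) = Ioo 0 1 := by
  have hm := strictMono_integral_Iic hp hi h0
  have hbot : Tendsto (fun y => ∫ t in Iic y, p t) atBot (𝓝 0) :=
    tendsto_integral_Iic_zero tendsto_id
  have htop : Tendsto (fun y => ∫ t in Iic y, p t) atTop (𝓝 1) := by
    rw [← h1]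
    exact (aecover_Iic tendsto_id).integral_tendsto_of_countably_generated hi
  have hc : Continuous fun y => ∫ t in Iic y, p t :=
    continuous_iff_continuousAt.2 fun x =>
      (hasStrictDerivAt_integral_Iic hp hi x).hasDerivAt.continuousAt
  ext y
  constructor
  · rintro ⟨x, rfl⟩
    constructor
    · exact lt_of_le_of_lt (hm.monotone.le_of_tendsto hbot (x - 1)) (hm (by linarith))
    · exact lt_of_lt_of_le (hm (show x < x + 1 by linarith))
        (hm.monotone.ge_of_tendsto htop (x + 1))
  · rintro ⟨hy0, hy1⟩
    exact mem_range_of_exists_le_of_exists_ge hc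
      ((hbot.eventually (gt_mem_nhds hy0)).exists.imp fun _ h => h.le)
      ((htop.eventually (lt_mem_nhds hy1)).exists.imp fun _ h => h.le)

/-- Monotone transport on the line between two continuous positive probability densities. -/
lemma exists_monotone_transport {p q : ℝ → ℝ} (hp : Continuous p) (hpi : Integrable p)
    (hp0 : ∀ x, 0 < p x) (hp1 : ∫ x, p x = 1) (hq : Continuous q) (hqi : Integrable q)
    (hq0 : ∀ x, 0 < q x) (hq1 : ∫ x, q x = 1) :
    ∃ T : ℝ → ℝ, (∀ x, ∫ t in Iic (T x), q t = ∫ t in Iic x, p t) ∧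
      ∀ x, HasDerivAt T (p x / q (T x)) x := by
  have hmq := strictMono_integral_Iic hq hqi hq0
  have hr := (range_integral_Iic hp hpi hp0 hp1).trans (range_integral_Iic hq hqi hq0 hq1).symm
  set Fp : ℝ → ℝ := fun y => ∫ t in Iic y, p t
  set Fq : ℝ → ℝ := fun y => ∫ t in Iic y, q t
  have hinv : ∀ y, Function.invFun Fq (Fq y) = y := Function.leftInverse_invFun hmq.injective
  have hT : ∀ x, Fq (Function.invFun Fq (Fp x)) = Fp x := fun x =>
    Function.invFun_eq (hr.subset (mem_range_self x))
  refine ⟨fun x => Function.invFun Fq (Fp x), hT, fun x => ?_⟩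
  have hQ := (hasStrictDerivAt_integral_Iic hq hqi
    (Function.invFun Fq (Fp x))).to_local_left_inverse (hq0 _).ne' (Eventually.of_forall hinv)
  change HasStrictDerivAt _ _ (Fq _) at hQ
  rw [hT] at hQ
  have := (hQ.comp x (hasStrictDerivAt_integral_Iic hp hpi x)).hasDerivAt
  rwa [inv_mul_eq_div] at this

/-- The standard Gaussian density. -/
abbrev stdPDF : ℝ → ℝ := gaussianPDFReal 0 1

lemma stdPDF_pos (x : ℝ) : 0 < stdPDF x := gaussianPDFReal_pos 0 1 x one_ne_zero

lemma stdPDF_eq (x : ℝ) : stdPDF x = (√(2 * Real.pi))⁻¹ * Real.exp (-x ^ 2 / 2) := by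
  simp [stdPDF, gaussianPDFReal]

lemma continuous_stdPDF : Continuous stdPDF := by
  rw [show stdPDF = _ from funext stdPDF_eq]
  fun_prop

lemma integrable_stdPDF : Integrable stdPDF := integrable_gaussianPDFReal 0 1

lemma integral_stdPDF : ∫ x, stdPDF x = 1 := integral_gaussianPDFReal_eq_one 0 one_ne_zero

lemma hasDerivAt_stdPDF (x : ℝ) : HasDerivAt stdPDF (-x * stdPDF x) x := by
  rw [show stdPDF = _ from funext stdPDF_eq]
  have h : HasDerivAt (fun y : ℝ => -y ^ 2 / 2) (-x) x := by
    exact (((hasDerivAt_pow 2 x).fun_neg).div_const 2).congr_deriv (by push_cast; ring)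
  exact ((h.exp).const_mul ((√(2 * Real.pi))⁻¹)).congr_deriv (by ring)

lemma log_stdPDF (x : ℝ) : Real.log (stdPDF x) = Real.log ((√(2 * Real.pi))⁻¹) - x ^ 2 / 2 := by
  rw [stdPDF_eq, Real.log_mul (by positivity) (by positivity), Real.log_exp]
  ring

lemma stdPDF_sub_le {t K c : ℝ} (hc : Real.exp (-K ^ 2 / 2) ≤ c) (h : t * K ≤ 0) :
    stdPDF (t - K) ≤ c * stdPDF t := by
  have : stdPDF (t - K) = Real.exp (t * K) * Real.exp (-K ^ 2 / 2) * stdPDF t := by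
    rw [stdPDF_eq, stdPDF_eq, ← Real.exp_add, mul_left_comm, ← Real.exp_add]
    ring_nf
  rw [this]
  refine mul_le_mul_of_nonneg_right ?_ (stdPDF_pos t).le
  have h1 := Real.exp_le_one_iff.2 h
  nlinarith [Real.exp_pos (-K ^ 2 / 2)]

lemma setIntegral_stdPDF_preimage (K : ℝ) (s : Set ℝ) :
    ∫ t in (fun t => t - K) ⁻¹' s, stdPDF (t - K) = ∫ t in s, stdPDF t :=
  (measurePreserving_sub_right volume K).setIntegral_preimage_emb
    (MeasurableEquiv.subRight K).measurableEmbedding _ _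

/-- Linear growth of the transport of a density bounded below relative to the Gaussian. -/
lemma abs_transport_le {p T : ℝ → ℝ} {c K : ℝ} (hK : 0 ≤ K) (hcK : Real.exp (-K ^ 2 / 2) ≤ c)
    (hp : Continuous p) (hpi : Integrable p) (hp0 : ∀ x, 0 < p x) (hp1 : ∫ x, p x = 1)
    (hpc : ∀ x, c * stdPDF x ≤ p x)
    (hT : ∀ x, ∫ t in Iic (T x), stdPDF t = ∫ t in Iic x, p t) (x : ℝ) :
    |T x| ≤ |x| + K := by
  have hmp := strictMono_integral_Iic hp hpi hp0
  have hmq := strictMono_integral_Iic continuous_stdPDF integrable_stdPDF stdPDF_pos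
  have hmono : Monotone T := fun x y hxy => by
    rw [← hmq.le_iff_le]
    simp only [hT]
    exact hmp.monotone hxy
  have hlow : ∀ x ≤ 0, x - K ≤ T x := fun x hx => by
    rw [← hmq.le_iff_le]
    simp only [hT]
    rw [← setIntegral_stdPDF_preimage K]
    have hs : (fun t => t - K) ⁻¹' Iic (x - K) = Iic x := by ext; simp
    rw [hs]
    refine setIntegral_mono_on (integrable_stdPDF.comp_sub_right K).integrableOn hpi.integrableOn
      measurableSet_Iic fun t ht => ?_
    exact (stdPDF_sub_le hcK (mul_nonpos_of_nonpos_of_nonneg (ht.trans hx) hK)).trans (hpc t)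
  have hup : ∀ x, 0 ≤ x → T x ≤ x + K := fun x hx => by
    rw [← hmq.le_iff_le]
    simp only [hT]
    have h1 := integral_add_compl (measurableSet_Iic (a := x)) hpi
    have h2 := integral_add_compl (measurableSet_Iic (a := x + K)) integrable_stdPDF
    rw [integral_stdPDF, compl_Iic] at h2
    rw [hp1, compl_Iic] at h1
    have h3 : ∫ t in Ioi (x + K), stdPDF t ≤ ∫ t in Ioi x, p t := by
      rw [← setIntegral_stdPDF_preimage (-K)]
      have hs : (fun t => t - -K) ⁻¹' Ioi (x + K) = Ioi x := by ext; simp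
      rw [hs]
      refine setIntegral_mono_on (integrable_stdPDF.comp_sub_right (-K)).integrableOn
        hpi.integrableOn measurableSet_Ioi fun t ht => ?_
      have ht' : 0 ≤ t := hx.trans (le_of_lt ht)
      exact (stdPDF_sub_le (by simpa using hcK) (by nlinarith)).trans (hpc t)
    linarith
  have h0 := hlow 0 le_rfl
  have h0' := hup 0 le_rfl
  rw [abs_le]
  rcases le_total x 0 with hx | hx
  · rw [abs_of_nonpos hx]
    have := hlow x hx
    have := hmono hx
    constructor <;> linarith
  · rw [abs_of_nonneg hx]
    have := hup x hx
    have := hmono hx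
    constructor <;> linarith

lemma integrable_gaussianReal_iff {f : ℝ → ℝ} :
    Integrable f (gaussianReal 0 1) ↔ Integrable fun x => stdPDF x * f x := by
  rw [gaussianReal_of_var_ne_zero 0 one_ne_zero,
    integrable_withDensity_iff_integrable_smul' (measurable_gaussianPDF 0 1)
      (ae_of_all _ fun _ => gaussianPDF_lt_top)]
  simp [toReal_gaussianPDF]

lemma integral_gaussianReal_eq (f : ℝ → ℝ) :
    ∫ x, f x ∂(gaussianReal 0 1) = ∫ x, stdPDF x * f x :=
  integral_gaussianReal_eq_integral_smul one_ne_zero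

lemma integrable_exp_mul_abs_gaussianReal (a : ℝ) :
    Integrable (fun x => Real.exp (a * |x|)) (gaussianReal 0 1) := by
  refine ((integrable_exp_mul_gaussianReal a).add (integrable_exp_mul_gaussianReal (-a))).mono'
    (by fun_prop) (ae_of_all _ fun x => ?_)
  rw [Real.norm_of_nonneg (Real.exp_pos _).le, Pi.add_apply]
  rcases abs_cases x with ⟨h, _⟩ | ⟨h, _⟩ <;> rw [h]
  · linarith [Real.exp_pos (-a * x)]
  · rw [mul_neg, ← neg_mul]
    linarith [Real.exp_pos (a * x)]

lemma integrable_of_abs_le {α : Type*} [MeasurableSpace α] {μ : Measure α} [IsFiniteMeasure μ]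
    {f : α → ℝ} {C : ℝ} (hf : Measurable f) (h : ∀ x, |f x| ≤ C) : Integrable f μ :=
  Integrable.of_bound hf.aestronglyMeasurable C (ae_of_all _ h)

lemma abs_log_le {c C t : ℝ} (hc : 0 < c) (h1 : c ≤ t) (h2 : t ≤ C) :
    |Real.log t| ≤ |Real.log c| + |Real.log C| := by
  have ht := hc.trans_le h1
  have := Real.log_le_log hc h1
  have := Real.log_le_log ht h2
  have := neg_abs_le (Real.log c)
  have := le_abs_self (Real.log C)
  have := abs_nonneg (Real.log c)
  have := abs_nonneg (Real.log C)
  rw [abs_le]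
  constructor <;> linarith

/-- The Gaussian logarithmic Sobolev inequality on the line for a probability density, by
monotone transport. -/
lemma integral_mul_log_le_of_integral_eq_one {g g' : ℝ → ℝ} {c C D : ℝ} (hc : 0 < c)
    (hg : ∀ x, HasDerivAt g (g' x) x) (hcg : ∀ x, c ≤ g x) (hgC : ∀ x, g x ≤ C)
    (hD : ∀ x, |g' x| ≤ D) (h1 : ∫ x, g x ∂(gaussianReal 0 1) = 1) :
    ∫ x, g x * Real.log (g x) ∂(gaussianReal 0 1)
      ≤ ∫ x, g' x ^ 2 / (2 * g x) ∂(gaussianReal 0 1) := by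
  have hgp : ∀ x, 0 < g x := fun x => hc.trans_le (hcg x)
  have hgc : Continuous g := continuous_iff_continuousAt.2 fun x => (hg x).continuousAt
  have hg'm : Measurable g' := by
    rw [show g' = deriv g from funext fun x => (hg x).deriv.symm]
    exact measurable_deriv g
  have habs : ∀ x, |g x| ≤ C := fun x => by rw [abs_of_pos (hgp x)]; exact hgC x
  have hgi : Integrable g (gaussianReal 0 1) := integrable_of_abs_le hgc.measurable habs
  -- the transport map
  set p : ℝ → ℝ := fun x => stdPDF x * g x with hp
  have hpc : Continuous p := continuous_stdPDF.mul hgc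
  have hpi : Integrable p := integrable_gaussianReal_iff.1 hgi
  have hp0 : ∀ x, 0 < p x := fun x => mul_pos (stdPDF_pos x) (hgp x)
  have hp1 : ∫ x, p x = 1 := by rw [← h1, integral_gaussianReal_eq]
  obtain ⟨T, hTF, hT⟩ := exists_monotone_transport hpc hpi hp0 hp1 continuous_stdPDF
    integrable_stdPDF stdPDF_pos integral_stdPDF
  obtain ⟨K, hK, hcK⟩ : ∃ K : ℝ, 0 ≤ K ∧ Real.exp (-K ^ 2 / 2) ≤ c := by
    refine ⟨√(2 * |Real.log c|), by positivity, ?_⟩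
    rw [Real.sq_sqrt (by positivity), ← Real.le_log_iff_exp_le hc]
    linarith [neg_abs_le (Real.log c)]
  have hTb := abs_transport_le hK hcK hpc hpi hp0 hp1
    (fun x => by rw [hp, mul_comm]; exact mul_le_mul_of_nonneg_left (hcg x) (stdPDF_pos x).le) hTF
  have hTc : Continuous T := continuous_iff_continuousAt.2 fun x => (hT x).continuousAt
  set T' : ℝ → ℝ := fun x => p x / stdPDF (T x) with hT'
  have hT'c : Continuous T' :=
    hpc.div (continuous_stdPDF.comp hTc) fun x => (stdPDF_pos _).ne'
  have hT'p : ∀ x, 0 < T' x := fun x => div_pos (hp0 x) (stdPDF_pos _)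
  set u : ℝ → ℝ := fun x => T x - x with hu
  have huc : Continuous u := hTc.sub continuous_id
  have hlogT' : ∀ x, Real.log (T' x) = Real.log (g x) + (T x ^ 2 - x ^ 2) / 2 := fun x => by
    rw [hT', hp]
    simp only
    rw [Real.log_div (hp0 x).ne' (stdPDF_pos _).ne', Real.log_mul (stdPDF_pos _).ne' (hgp x).ne',
      log_stdPDF, log_stdPDF]
    ring
  -- integrability with respect to the Gaussian
  have hT'i : Integrable T' (gaussianReal 0 1) := by
    refine ((integrable_exp_mul_abs_gaussianReal K).const_mul (C * Real.exp (K ^ 2 / 2))).mono'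
      hT'c.aestronglyMeasurable (ae_of_all _ fun x => ?_)
    have h2 : T' x = g x * Real.exp ((T x ^ 2 - x ^ 2) / 2) := by
      rw [← Real.exp_log (hT'p x), hlogT', Real.exp_add, Real.exp_log (hgp x)]
    rw [Real.norm_of_nonneg (hT'p x).le, h2, mul_assoc, ← Real.exp_add]
    have h3 : (T x ^ 2 - x ^ 2) / 2 ≤ K ^ 2 / 2 + K * |x| := by
      nlinarith [sq_abs (T x), sq_abs x, hTb x, abs_nonneg (T x), abs_nonneg x]
    exact mul_le_mul (hgC x) (Real.exp_le_exp.2 h3) (Real.exp_pos _).le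
      ((abs_nonneg _).trans (habs 0))
  have hx_le : ∀ x : ℝ, |x| ≤ Real.exp |x| := fun x => by linarith [Real.add_one_le_exp |x|]
  have hx2i : Integrable (fun x : ℝ => x ^ 2) (gaussianReal 0 1) := by
    refine (integrable_exp_mul_abs_gaussianReal 2).mono' (by fun_prop) (ae_of_all _ fun x => ?_)
    rw [Real.norm_of_nonneg (sq_nonneg x), two_mul, Real.exp_add, ← sq_abs, sq]
    exact mul_le_mul (hx_le x) (hx_le x) (abs_nonneg x) (Real.exp_pos _).le
  have hu2i : Integrable (fun x => u x ^ 2) (gaussianReal 0 1) := by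
    refine ((hx2i.const_mul 8).add (integrable_const (2 * K ^ 2))).mono'
      (huc.pow 2).aestronglyMeasurable (ae_of_all _ fun x => ?_)
    have h2 : |u x| ≤ 2 * |x| + K := by
      have := abs_sub (T x) x
      linarith [hTb x]
    rw [Real.norm_of_nonneg (sq_nonneg _), Pi.add_apply]
    nlinarith [sq_abs (u x), sq_abs x, abs_nonneg (u x), abs_nonneg x, sq_nonneg (2 * |x| - K)]
  have hui : Integrable u (gaussianReal 0 1) := by
    refine ((integrable_const (1 : ℝ)).add hu2i).mono' huc.aestronglyMeasurable
      (ae_of_all _ fun x => ?_)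
    rw [Pi.add_apply, Real.norm_eq_abs]
    nlinarith [sq_abs (u x), sq_nonneg (|u x| - 1)]
  have hxui : Integrable (fun x => x * u x) (gaussianReal 0 1) := by
    refine (hx2i.add hu2i).mono' (by fun_prop) (ae_of_all _ fun x => ?_)
    rw [Pi.add_apply, Real.norm_eq_abs, abs_le]
    constructor <;> nlinarith [sq_nonneg (x + u x), sq_nonneg (x - u x)]
  have hwi : Integrable (fun x => T' x - 1 - x * u x) (gaussianReal 0 1) :=
    (hT'i.sub (integrable_const 1)).sub hxui
  have hgwi : Integrable (fun x => g x * (T' x - 1 - x * u x)) (gaussianReal 0 1) :=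
    hwi.bdd_mul hgc.aestronglyMeasurable (ae_of_all _ habs)
  have hg'ui : Integrable (fun x => g' x * u x) (gaussianReal 0 1) :=
    hui.bdd_mul hg'm.aestronglyMeasurable (ae_of_all _ hD)
  have hgui : Integrable (fun x => g x * u x) (gaussianReal 0 1) :=
    hui.bdd_mul hgc.aestronglyMeasurable (ae_of_all _ habs)
  have hgu2i : Integrable (fun x => g x * u x ^ 2) (gaussianReal 0 1) :=
    hu2i.bdd_mul hgc.aestronglyMeasurable (ae_of_all _ habs)
  have hlogi : Integrable (fun x => g x * Real.log (g x)) (gaussianReal 0 1) := by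
    refine hgi.mul_bdd (c := |Real.log c| + |Real.log C|)
      (Real.measurable_log.comp hgc.measurable).aestronglyMeasurable (ae_of_all _ fun x => ?_)
    exact abs_log_le hc (hcg x) (hgC x)
  have hRi : Integrable (fun x => g' x ^ 2 / (2 * g x)) (gaussianReal 0 1) := by
    refine integrable_of_abs_le (C := D ^ 2 / (2 * c))
      ((hg'm.pow_const 2).div (hgc.measurable.const_mul 2)) fun x => ?_
    have := hgp x
    rw [abs_of_nonneg (by positivity)]
    refine div_le_div₀ (sq_nonneg D) ?_ (by positivity) (by linarith [hcg x])
    rw [← sq_abs]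
    exact pow_le_pow_left₀ (abs_nonneg _) (hD x) 2
  -- Gaussian integration by parts
  have hibp : ∫ x, g x * (T' x - 1 - x * u x) ∂(gaussianReal 0 1)
      = - ∫ x, g' x * u x ∂(gaussianReal 0 1) := by
    rw [integral_gaussianReal_eq, integral_gaussianReal_eq]
    have hv : ∀ x, HasDerivAt (fun y => u y * stdPDF y) ((T' x - 1 - x * u x) * stdPDF x) x :=
      fun x => (((hT x).sub (hasDerivAt_id x)).mul (hasDerivAt_stdPDF x)).congr_deriv (by
        simp only [Pi.sub_apply, id, hu, hT']
        ring)
    have e1 : (fun x => stdPDF x * (g x * (T' x - 1 - x * u x)))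
        = g * fun x => (T' x - 1 - x * u x) * stdPDF x := by
      funext x; simp only [Pi.mul_apply]; ring
    have e2 : (fun x => stdPDF x * (g' x * u x)) = g' * fun x => u x * stdPDF x := by
      funext x; simp only [Pi.mul_apply]; ring
    have e3 : (fun x => stdPDF x * (g x * u x)) = g * fun x => u x * stdPDF x := by
      funext x; simp only [Pi.mul_apply]; ring
    have i1 := integrable_gaussianReal_iff.1 hgwi
    have i2 := integrable_gaussianReal_iff.1 hg'ui
    have i3 := integrable_gaussianReal_iff.1 hgui
    rw [e1] at i1 ⊢
    rw [e2] at i2 ⊢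
    rw [e3] at i3
    exact integral_mul_deriv_eq_deriv_mul_of_integrable (fun x _ => hg x) (fun x _ => hv x) i1 i2 i3
  calc ∫ x, g x * Real.log (g x) ∂(gaussianReal 0 1)
      ≤ ∫ x, (g x * (T' x - 1 - x * u x) - 2⁻¹ * (g x * u x ^ 2)) ∂(gaussianReal 0 1) := by
        refine integral_mono hlogi (hgwi.sub (hgu2i.const_mul _)) fun x => ?_
        have h2 := Real.log_le_sub_one_of_pos (hT'p x)
        rw [hlogT'] at h2
        have h3 : Real.log (g x) ≤ T' x - 1 - x * u x - 2⁻¹ * u x ^ 2 := by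
          simp only [hu]
          nlinarith
        have h4 := mul_le_mul_of_nonneg_left h3 (hgp x).le
        simp only
        linarith
    _ = ∫ x, (-(g' x * u x) - 2⁻¹ * (g x * u x ^ 2)) ∂(gaussianReal 0 1) := by
        rw [integral_sub hgwi (hgu2i.const_mul _),
          integral_sub (f := fun x => -(g' x * u x)) hg'ui.neg (hgu2i.const_mul _), hibp,
          integral_neg]
    _ ≤ ∫ x, g' x ^ 2 / (2 * g x) ∂(gaussianReal 0 1) := by
        refine integral_mono (hg'ui.neg.sub (hgu2i.const_mul _)) hRi fun x => ?_
        have := hgp x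
        rw [le_div_iff₀ (by positivity)]
        beta_reduce
        nlinarith [sq_nonneg (g' x + g x * u x)]

lemma integrable_mul_log {α : Type*} [MeasurableSpace α] {μ : Measure α} [IsFiniteMeasure μ]
    {k w : α → ℝ} {B c C : ℝ} (hc : 0 < c) (hk : Measurable k) (hkB : ∀ x, |k x| ≤ B)
    (hw : Measurable w) (hcw : ∀ x, c ≤ w x) (hwC : ∀ x, w x ≤ C) :
    Integrable (fun x => k x * Real.log (w x)) μ :=
  (integrable_of_abs_le hk hkB).mul_bdd (c := |Real.log c| + |Real.log C|)
    (Real.measurable_log.comp hw).aestronglyMeasurable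
    (ae_of_all _ fun x => abs_log_le hc (hcw x) (hwC x))

lemma le_integral_of_le {α : Type*} [MeasurableSpace α] {μ : Measure α} [IsProbabilityMeasure μ]
    {k : α → ℝ} {c : ℝ} (hk : Integrable k μ) (h : ∀ x, c ≤ k x) : c ≤ ∫ x, k x ∂μ := by
  simpa using integral_mono (μ := μ) (integrable_const c) hk h

lemma integral_le_of_le {α : Type*} [MeasurableSpace α] {μ : Measure α} [IsProbabilityMeasure μ]
    {k : α → ℝ} {c : ℝ} (hk : Integrable k μ) (h : ∀ x, k x ≤ c) : ∫ x, k x ∂μ ≤ c := by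
  simpa using integral_mono (μ := μ) hk (integrable_const c) h

/-- The logarithmic Sobolev inequality for the standard Gaussian on the line. -/
lemma ent_gaussianReal_sq_add_le {g g' : ℝ → ℝ} {C D δ : ℝ} (hδ : 0 < δ)
    (hg : ∀ x, HasDerivAt g (g' x) x) (hC : ∀ x, |g x| ≤ C) (hD : ∀ x, |g' x| ≤ D) :
    Ent (gaussianReal 0 1) (fun x => g x ^ 2 + δ) ≤ ∫ x, 2 * g' x ^ 2 ∂(gaussianReal 0 1) := by
  have hgc : Continuous g := continuous_iff_continuousAt.2 fun x => (hg x).continuousAt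
  have hg'm : Measurable g' := by
    rw [show g' = deriv g from funext fun x => (hg x).deriv.symm]
    exact measurable_deriv g
  have hGm : Measurable fun x => g x ^ 2 + δ := by fun_prop
  have hlow : ∀ x, δ ≤ g x ^ 2 + δ := fun x => by linarith [sq_nonneg (g x)]
  have hup : ∀ x, g x ^ 2 + δ ≤ C ^ 2 + δ := fun x => by
    have := sq_le_sq' (abs_le.1 (hC x)).1 (abs_le.1 (hC x)).2
    linarith
  have hGabs : ∀ x, |g x ^ 2 + δ| ≤ C ^ 2 + δ := fun x => by
    rw [abs_of_pos (by positivity)]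
    exact hup x
  have hGi : Integrable (fun x => g x ^ 2 + δ) (gaussianReal 0 1) :=
    integrable_of_abs_le hGm hGabs
  have hGl : Integrable (fun x => (g x ^ 2 + δ) * Real.log (g x ^ 2 + δ)) (gaussianReal 0 1) :=
    integrable_mul_log hδ hGm hGabs hGm hlow hup
  set m := ∫ x, (g x ^ 2 + δ) ∂(gaussianReal 0 1) with hm
  have hm0 : 0 < m := hδ.trans_le (le_integral_of_le hGi hlow)
  have key := integral_mul_log_le_of_integral_eq_one (g := fun x => m⁻¹ * (g x ^ 2 + δ))
    (g' := fun x => m⁻¹ * (2 * g x * g' x)) (c := m⁻¹ * δ) (C := m⁻¹ * (C ^ 2 + δ))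
    (D := m⁻¹ * (2 * C * D)) (by positivity)
    (fun x => ((((hg x).fun_pow 2).add_const δ).const_mul m⁻¹).congr_deriv (by push_cast; ring))
    (fun x => mul_le_mul_of_nonneg_left (hlow x) (inv_pos.2 hm0).le)
    (fun x => mul_le_mul_of_nonneg_left (hup x) (inv_pos.2 hm0).le)
    (fun x => by
      rw [abs_mul, abs_mul, abs_mul, abs_of_pos (inv_pos.2 hm0), abs_two]
      have := (abs_nonneg _).trans (hC x)
      gcongr
      · exact hC x
      · exact hD x)
    (by rw [integral_const_mul, ← hm, inv_mul_cancel₀ hm0.ne'])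
  have hL : ∫ x, m⁻¹ * (g x ^ 2 + δ) * Real.log (m⁻¹ * (g x ^ 2 + δ)) ∂(gaussianReal 0 1)
      = m⁻¹ * Ent (gaussianReal 0 1) (fun x => g x ^ 2 + δ) := by
    have e : ∀ x, m⁻¹ * (g x ^ 2 + δ) * Real.log (m⁻¹ * (g x ^ 2 + δ))
        = m⁻¹ * ((g x ^ 2 + δ) * Real.log (g x ^ 2 + δ) - (g x ^ 2 + δ) * Real.log m) := fun x => by
      rw [Real.log_mul (by positivity) (by positivity), Real.log_inv]
      ring
    simp_rw [e]
    rw [integral_const_mul, integral_sub hGl (hGi.mul_const _), integral_mul_const, ← hm, Ent]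
  rw [hL] at key
  have hR : ∫ x, (m⁻¹ * (2 * g x * g' x)) ^ 2 / (2 * (m⁻¹ * (g x ^ 2 + δ))) ∂(gaussianReal 0 1)
      ≤ ∫ x, m⁻¹ * (2 * g' x ^ 2) ∂(gaussianReal 0 1) := by
    refine integral_mono_of_nonneg (ae_of_all _ fun x => by positivity) ?_ (ae_of_all _ fun x => ?_)
    · refine Integrable.const_mul (Integrable.const_mul ?_ _) _
      refine integrable_of_abs_le (C := D ^ 2) (hg'm.pow_const 2) fun x => ?_
      rw [abs_pow]
      exact pow_le_pow_left₀ (abs_nonneg _) (hD x) 2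
    · have h1 : 0 < g x ^ 2 + δ := by positivity
      have h2 : (m⁻¹ * (2 * g x * g' x)) ^ 2 / (2 * (m⁻¹ * (g x ^ 2 + δ)))
          = m⁻¹ * (2 * g' x ^ 2) * (g x ^ 2 / (g x ^ 2 + δ)) := by
        field_simp
      beta_reduce
      rw [h2]
      exact mul_le_of_le_one_right (by positivity) ((div_le_one h1).2 (by linarith))
  rw [integral_const_mul] at hR
  exact le_of_mul_le_mul_left (key.trans hR) (inv_pos.2 hm0)

/-- Variational lower bound for the entropy. -/
lemma integral_mul_log_sub_le_ent {α : Type*} [MeasurableSpace α] {μ : Measure α}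
    [IsProbabilityMeasure μ] {k w : α → ℝ} {c C : ℝ} (hc : 0 < c) (hk : Measurable k)
    (hck : ∀ x, c ≤ k x) (hkC : ∀ x, k x ≤ C) (hw : Measurable w) (hcw : ∀ x, c ≤ w x)
    (hwC : ∀ x, w x ≤ C) :
    ∫ x, k x * Real.log (w x) ∂μ - (∫ x, k x ∂μ) * Real.log (∫ x, w x ∂μ) ≤ Ent μ k := by
  have hkp : ∀ x, 0 < k x := fun x => hc.trans_le (hck x)
  have hwp : ∀ x, 0 < w x := fun x => hc.trans_le (hcw x)
  have hka : ∀ x, |k x| ≤ C := fun x => by rw [abs_of_pos (hkp x)]; exact hkC x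
  have hwa : ∀ x, |w x| ≤ C := fun x => by rw [abs_of_pos (hwp x)]; exact hwC x
  have hki : Integrable k μ := integrable_of_abs_le hk hka
  have hwi : Integrable w μ := integrable_of_abs_le hw hwa
  have hkw : Integrable (fun x => k x * Real.log (w x)) μ :=
    integrable_mul_log hc hk hka hw hcw hwC
  have hkk : Integrable (fun x => k x * Real.log (k x)) μ :=
    integrable_mul_log hc hk hka hk hck hkC
  set M := ∫ x, k x ∂μ with hM
  set m := ∫ x, w x ∂μ with hm
  have hM0 : 0 < M := hc.trans_le (le_integral_of_le hki hck)
  have hm0 : 0 < m := hc.trans_le (le_integral_of_le hwi hcw)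
  have hpt : ∀ x, k x * Real.log (w x) - k x * Real.log m - k x * Real.log (k x)
      + k x * Real.log M ≤ M / m * w x - k x := fun x => by
    have h := Real.log_le_sub_one_of_pos
      (show 0 < M / m * w x / k x from div_pos (mul_pos (div_pos hM0 hm0) (hwp x)) (hkp x))
    rw [Real.log_div (mul_pos (div_pos hM0 hm0) (hwp x)).ne' (hkp x).ne',
      Real.log_mul (div_pos hM0 hm0).ne' (hwp x).ne', Real.log_div hM0.ne' hm0.ne'] at h
    have h' := mul_le_mul_of_nonneg_left h (hkp x).le
    have e : k x * (M / m * w x / k x - 1) = M / m * w x - k x := by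
      have := (hkp x).ne'
      field_simp
    rw [e] at h'
    linarith
  have hint := integral_mono (((hkw.sub (hki.mul_const _)).sub hkk).add (hki.mul_const _))
    ((hwi.const_mul (M / m)).sub hki) hpt
  rw [integral_add' ((hkw.sub (hki.mul_const _)).sub hkk) (hki.mul_const _),
    integral_sub' (hkw.sub (hki.mul_const _)) hkk, integral_sub' hkw (hki.mul_const _),
    integral_sub' (hwi.const_mul (M / m)) hki, integral_mul_const, integral_mul_const,
    integral_const_mul, ← hM, ← hm, div_mul_cancel₀ _ hm0.ne'] at hint
  rw [Ent, ← hM]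
  linarith

/-- Tensorization of entropy bounds over a product of two probability spaces. -/
lemma ent_prod_le {α γ : Type*} [MeasurableSpace α] [MeasurableSpace γ] {μ : Measure α}
    {ν : Measure γ} [IsProbabilityMeasure μ] [IsProbabilityMeasure ν] {F D₁ D₂ : α × γ → ℝ}
    {c C : ℝ} (hc : 0 < c) (hF : Measurable F) (hcF : ∀ p, c ≤ F p) (hFC : ∀ p, F p ≤ C)
    (hD₁ : Integrable D₁ (μ.prod ν)) (hD₂ : Integrable D₂ (μ.prod ν))
    (h₁ : ∀ᵐ y ∂ν, Ent μ (fun x => F (x, y)) ≤ ∫ x, D₁ (x, y) ∂μ)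
    (h₂ : ∀ᵐ x ∂μ, Ent ν (fun y => F (x, y)) ≤ ∫ y, D₂ (x, y) ∂ν) :
    Ent (μ.prod ν) F ≤ ∫ p, D₁ p ∂(μ.prod ν) + ∫ p, D₂ p ∂(μ.prod ν) := by
  have hFp : ∀ p, 0 < F p := fun p => hc.trans_le (hcF p)
  have hFa : ∀ p, |F p| ≤ C := fun p => by rw [abs_of_pos (hFp p)]; exact hFC p
  have hFi : Integrable F (μ.prod ν) := integrable_of_abs_le hF hFa
  have hFl : Integrable (fun p => F p * Real.log (F p)) (μ.prod ν) :=
    integrable_mul_log hc hF hFa hF hcF hFC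
  have hF1 : ∀ y, Measurable fun x => F (x, y) := fun y => hF.comp measurable_prodMk_right
  have hF2 : ∀ x, Measurable fun y => F (x, y) := fun x => hF.comp measurable_prodMk_left
  have hF1i : ∀ y, Integrable (fun x => F (x, y)) μ := fun y =>
    integrable_of_abs_le (hF1 y) fun _ => hFa _
  set G : γ → ℝ := fun y => ∫ x, F (x, y) ∂μ with hG
  have hGm : Measurable G := (hF.stronglyMeasurable.integral_prod_left').measurable
  have hcG : ∀ y, c ≤ G y := fun y => le_integral_of_le (hF1i y) fun _ => hcF _
  have hGC : ∀ y, G y ≤ C := fun y => integral_le_of_le (hF1i y) fun _ => hFC _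
  have hGa : ∀ y, |G y| ≤ C := fun y => by
    rw [abs_of_pos (hc.trans_le (hcG y))]; exact hGC y
  have hGl : Integrable (fun y => G y * Real.log (G y)) ν :=
    integrable_mul_log hc hGm hGa hGm hcG hGC
  have hFG : Integrable (fun p : α × γ => F p * Real.log (G p.2)) (μ.prod ν) :=
    integrable_mul_log hc hF hFa (hGm.comp measurable_snd) (fun p => hcG _) fun p => hGC _
  have hm : ∫ y, G y ∂ν = ∫ p, F p ∂(μ.prod ν) := (integral_prod_symm F hFi).symm
  -- the conditional entropy given the second variable
  have hA : ∫ p, F p * Real.log (F p) ∂(μ.prod ν) - ∫ y, G y * Real.log (G y) ∂ν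
      ≤ ∫ p, D₁ p ∂(μ.prod ν) := by
    rw [integral_prod_symm _ hFl, integral_prod_symm _ hD₁,
      ← integral_sub hFl.integral_prod_right hGl]
    refine integral_mono_ae (hFl.integral_prod_right.sub hGl) hD₁.integral_prod_right ?_
    filter_upwards [h₁] with y hy using hy
  -- the entropy of the marginal
  have hB : ∫ y, G y * Real.log (G y) ∂ν - (∫ y, G y ∂ν) * Real.log (∫ y, G y ∂ν)
      ≤ ∫ p, D₂ p ∂(μ.prod ν) := by
    have e1 : ∫ y, G y * Real.log (G y) ∂ν = ∫ x, ∫ y, F (x, y) * Real.log (G y) ∂ν ∂μ := by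
      rw [← integral_prod _ hFG, integral_prod_symm _ hFG]
      simp_rw [integral_mul_const]
      rfl
    have e2 : (∫ y, G y ∂ν) * Real.log (∫ y, G y ∂ν)
        = ∫ x, (∫ y, F (x, y) ∂ν) * Real.log (∫ y, G y ∂ν) ∂μ := by
      rw [integral_mul_const, ← integral_prod _ hFi, hm]
    rw [e1, e2, integral_prod _ hD₂, ← integral_sub hFG.integral_prod_left
      (hFi.integral_prod_left.mul_const _)]
    refine integral_mono_ae (hFG.integral_prod_left.sub (hFi.integral_prod_left.mul_const _))
      hD₂.integral_prod_left ?_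
    filter_upwards [h₂] with x hx
    exact (integral_mul_log_sub_le_ent hc (hF2 x) (fun _ => hcF _) (fun _ => hFC _) hGm hcG
      hGC).trans hx
  rw [Ent, ← hm]
  linarith

lemma MeasureTheory.MeasurePreserving.ent_comp {α γ : Type*} [MeasurableSpace α]
    [MeasurableSpace γ] {μ : Measure α} {ν : Measure γ} {e : α ≃ᵐ γ} (he : MeasurePreserving e μ ν)
    (F : γ → ℝ) : Ent μ (fun x => F (e x)) = Ent ν F := by
  rw [Ent, Ent, he.integral_comp' F, he.integral_comp' fun y => F y * Real.log (F y)]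

/-- Tensorization of entropy bounds over a finite power of a probability space. -/
lemma ent_pi_le {α : Type*} [MeasurableSpace α] {μ : Measure α} [IsProbabilityMeasure μ]
    {c C : ℝ} (hc : 0 < c) : ∀ (n : ℕ) {F : (Fin n → α) → ℝ} {D : Fin n → (Fin n → α) → ℝ},
    Measurable F → (∀ v, c ≤ F v) → (∀ v, F v ≤ C) →
    (∀ i, Integrable (D i) (Measure.pi fun _ => μ)) →
    (∀ i v, Ent μ (fun t => F (Function.update v i t)) ≤ ∫ t, D i (Function.update v i t) ∂μ) →
    Ent (Measure.pi fun _ => μ) F ≤ ∑ i, ∫ v, D i v ∂(Measure.pi fun _ => μ)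
  | 0, F, D, _, _, _, _, _ => by
    simp [Ent, integral_unique]
  | n + 1, F, D, hF, hcF, hFC, hD, h => by
    have he := (measurePreserving_piFinSuccAbove (fun _ : Fin (n + 1) => μ) 0).symm
    set e := (MeasurableEquiv.piFinSuccAbove (fun _ : Fin (n + 1) => α) 0).symm
    have hes : ∀ x w, e (x, w) = Fin.cons x w := fun x w => by
      simp [e, MeasurableEquiv.piFinSuccAbove]
      rfl
    have hDi : ∀ i, Integrable (fun p => D i (e p)) (μ.prod (Measure.pi fun _ : Fin n => μ)) :=
      fun i => he.integrable_comp_of_integrable (hD i)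
    have hsum : Integrable (fun p => ∑ i : Fin n, D i.succ (e p))
        (μ.prod (Measure.pi fun _ : Fin n => μ)) := integrable_finsetSum _ fun i _ => hDi _
    have key := ent_prod_le hc (hF.comp e.measurable) (fun p => hcF _) (fun p => hFC _) (hDi 0) hsum
      (ae_of_all _ fun w => ?_) ?_
    · rw [integral_finsetSum _ fun i _ => hDi _] at key
      rw [← he.ent_comp, Fin.sum_univ_succ]
      simp_rw [← he.integral_comp' (D _)]
      exact key
    · obtain ⟨x⟩ : Nonempty α := nonempty_of_isProbabilityMeasure μ
      simpa [hes, Fin.update_cons_zero] using h 0 (Fin.cons x w)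
    · have hae : ∀ᵐ x ∂μ, ∀ i : Fin n, Integrable (fun w => D i.succ (e (x, w)))
          (Measure.pi fun _ => μ) := ae_all_iff.2 fun i => (hDi i.succ).prod_right_ae
      filter_upwards [hae] with x hx
      rw [integral_finsetSum _ fun i _ => hx i]
      refine ent_pi_le hc n ((hF.comp e.measurable).comp measurable_prodMk_left)
        (fun _ => hcF _) (fun _ => hFC _) hx fun i w => ?_
      simpa [hes, Fin.cons_update] using h i.succ (Fin.cons x w)

instance : IsProbabilityMeasure stdGauss3 := by
  unfold stdGauss3
  infer_instance

instance (n : ℕ) : IsProbabilityMeasure (gaussN n) := by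
  unfold gaussN
  infer_instance

/-- The logarithmic Sobolev inequality for the standard Gaussian on `ℝ³`. -/
lemma ent_stdGauss3_sq_add_le {G gx gy gz : H → ℝ} {C D δ : ℝ} (hδ : 0 < δ)
    (hGm : Measurable G) (hxm : Measurable gx) (hym : Measurable gy) (hzm : Measurable gz)
    (hx : ∀ x y z, HasDerivAt (fun t => G (t, y, z)) (gx (x, y, z)) x)
    (hy : ∀ x y z, HasDerivAt (fun t => G (x, t, z)) (gy (x, y, z)) y)
    (hz : ∀ x y z, HasDerivAt (fun t => G (x, y, t)) (gz (x, y, z)) z)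
    (hC : ∀ p, |G p| ≤ C) (hxD : ∀ p, |gx p| ≤ D) (hyD : ∀ p, |gy p| ≤ D)
    (hzD : ∀ p, |gz p| ≤ D) :
    Ent stdGauss3 (fun p => G p ^ 2 + δ)
      ≤ ∫ p, 2 * (gx p ^ 2 + gy p ^ 2 + gz p ^ 2) ∂stdGauss3 := by
  have hsq : ∀ {α : Type} [MeasurableSpace α] (μ : Measure α) [IsProbabilityMeasure μ]
      {k : α → ℝ}, Measurable k → (∀ p, |k p| ≤ D) → Integrable (fun p => 2 * k p ^ 2) μ := by
    intro α _ μ _ k hk hkD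
    refine (integrable_of_abs_le (C := D ^ 2) (hk.pow_const 2) fun p => ?_).const_mul 2
    rw [abs_pow]
    exact pow_le_pow_left₀ (abs_nonneg _) (hkD p) 2
  have hFm : Measurable fun p => G p ^ 2 + δ := (hGm.pow_const 2).add_const δ
  have hlow : ∀ p, δ ≤ G p ^ 2 + δ := fun p => by linarith [sq_nonneg (G p)]
  have hup : ∀ p, G p ^ 2 + δ ≤ C ^ 2 + δ := fun p => by
    have := sq_le_sq' (abs_le.1 (hC p)).1 (abs_le.1 (hC p)).2
    linarith
  have hyz : ∀ x, Ent ((gaussianReal 0 1).prod (gaussianReal 0 1)) (fun q => G (x, q) ^ 2 + δ)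
      ≤ ∫ q, (2 * gy (x, q) ^ 2 + 2 * gz (x, q) ^ 2)
        ∂((gaussianReal 0 1).prod (gaussianReal 0 1)) := fun x => by
    have hyi := hsq ((gaussianReal 0 1).prod (gaussianReal 0 1))
      (hym.comp (measurable_prodMk_left (x := x))) fun q => hyD (x, q)
    have hzi := hsq ((gaussianReal 0 1).prod (gaussianReal 0 1))
      (hzm.comp (measurable_prodMk_left (x := x))) fun q => hzD (x, q)
    have := ent_prod_le hδ (hFm.comp (measurable_prodMk_left (x := x))) (fun q => hlow (x, q))
      (fun q => hup (x, q)) hyi hzi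
      (ae_of_all _ fun z => ent_gaussianReal_sq_add_le hδ (fun y => hy x y z) (fun _ => hC _)
        fun _ => hyD _)
      (ae_of_all _ fun y => ent_gaussianReal_sq_add_le hδ (fun z => hz x y z) (fun _ => hC _)
        fun _ => hzD _)
    exact this.trans_eq (integral_add hyi hzi).symm
  have hxi := hsq stdGauss3 hxm hxD
  have hyzi := (hsq stdGauss3 hym hyD).add (hsq stdGauss3 hzm hzD)
  have := ent_prod_le hδ hFm hlow hup hxi hyzi
    (ae_of_all _ fun q => ent_gaussianReal_sq_add_le hδ (fun x => hx x q.1 q.2) (fun _ => hC _)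
      fun _ => hxD _)
    (ae_of_all _ hyz)
  refine this.trans_eq ?_
  change ∫ p, 2 * gx p ^ 2 ∂stdGauss3 + ∫ p, _ ∂stdGauss3 = _
  rw [← integral_add hxi hyzi]
  refine integral_congr_ae (ae_of_all _ fun p => ?_)
  simp only [Pi.add_apply]
  ring

lemma hasDerivAt_comp_curve {f : H → ℝ} (hf : Differentiable ℝ f) {γ₁ γ₂ γ₃ : ℝ → ℝ}
    {a b c t : ℝ} (h₁ : HasDerivAt γ₁ a t) (h₂ : HasDerivAt γ₂ b t) (h₃ : HasDerivAt γ₃ c t) :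
    HasDerivAt (fun s => f (γ₁ s, γ₂ s, γ₃ s)) (fderiv ℝ f (γ₁ t, γ₂ t, γ₃ t) (a, b, c)) t :=
  ((hf _).hasFDerivAt).comp_hasDerivAt t (h₁.prodMk (h₂.prodMk h₃))

lemma pdx_eq {f : H → ℝ} (hf : Differentiable ℝ f) (p : H) : pdx f p = fderiv ℝ f p (1, 0, 0) :=
  (hasDerivAt_comp_curve hf (hasDerivAt_id p.1) (hasDerivAt_const _ p.2.1)
    (hasDerivAt_const _ p.2.2)).deriv

lemma pdy_eq {f : H → ℝ} (hf : Differentiable ℝ f) (p : H) : pdy f p = fderiv ℝ f p (0, 1, 0) :=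
  (hasDerivAt_comp_curve hf (hasDerivAt_const _ p.1) (hasDerivAt_id p.2.1)
    (hasDerivAt_const _ p.2.2)).deriv

lemma pdz_eq {f : H → ℝ} (hf : Differentiable ℝ f) (p : H) : pdz f p = fderiv ℝ f p (0, 0, 1) :=
  (hasDerivAt_comp_curve hf (hasDerivAt_const _ p.1) (hasDerivAt_const _ p.2.1)
    (hasDerivAt_id p.2.2)).deriv

lemma fderiv_apply_eq {f : H → ℝ} (hf : Differentiable ℝ f) (p : H) (a b c : ℝ) :
    fderiv ℝ f p (a, b, c) = a * pdx f p + b * pdy f p + c * pdz f p := by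
  have : ((a, b, c) : H) = a • (1, 0, 0) + b • (0, 1, 0) + c • (0, 0, 1) := by simp
  rw [this, map_add, map_add, map_smul, map_smul, map_smul, pdx_eq hf, pdy_eq hf, pdz_eq hf]
  rfl

/-- The functional inequality satisfied by a Schwartz function along one increment of the walk. -/
lemma ent_stdGauss3_translate_le (f : SchwartzMap H ℝ) {C D δ : ℝ} (hδ : 0 < δ)
    (hC : ∀ p, |f p| ≤ C) (hxD : ∀ p, |pdx f p| ≤ D) (hyD : ∀ p, |pdy f p| ≤ D)
    (hzD : ∀ p, |pdz f p| ≤ D) (hxc : Continuous (pdx f)) (hyc : Continuous (pdy f))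
    (hzc : Continuous (pdz f)) (β a X Y : ℝ) (p : H) {s : H → H}
    (hs : ∀ t, s t = (p.1 + a * t.1, p.2.1 + a * t.2.1,
      p.2.2 + a * (β * t.2.2 + (X * t.2.1 - Y * t.1) / 2))) :
    Ent stdGauss3 (fun t => f (s t) ^ 2 + δ)
      ≤ ∫ t, 2 * a ^ 2 * hfun β f (s t) (X, Y) ∂stdGauss3 := by
  have hsc : Continuous s := by
    rw [show s = _ from funext hs]
    fun_prop
  have hD0 : 0 ≤ D := (abs_nonneg _).trans (hxD 0)
  have hfd : Differentiable ℝ f := f.differentiable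
  have hbound : ∀ (k : ℝ) {w w' : ℝ}, |w| ≤ D → |w'| ≤ D → ∀ r, |k| ≤ r →
      |a * (w + k / 2 * w')| ≤ |a| * (D + r * D) := by
    intro k w w' hw hw' r hr
    rw [abs_mul]
    refine mul_le_mul_of_nonneg_left ((abs_add_le _ _).trans (add_le_add hw ?_)) (abs_nonneg a)
    rw [abs_mul, abs_div, abs_two]
    have := abs_nonneg k
    exact mul_le_mul (by linarith) hw' (abs_nonneg _) (by linarith)
  set r := |X| + |Y| + 2 * |β| with hr
  have hX : |X| ≤ r := by linarith [abs_nonneg Y, abs_nonneg β]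
  have hY : |-Y| ≤ r := by rw [abs_neg]; linarith [abs_nonneg X, abs_nonneg β]
  have hβ : |2 * β| ≤ r := by
    rw [abs_mul, abs_two]; linarith [abs_nonneg X, abs_nonneg Y]
  have key := ent_stdGauss3_sq_add_le (G := fun t => f (s t))
    (gx := fun t => a * (pdx f (s t) + -Y / 2 * pdz f (s t)))
    (gy := fun t => a * (pdy f (s t) + X / 2 * pdz f (s t)))
    (gz := fun t => a * (0 + 2 * β / 2 * pdz f (s t))) (C := C) (D := |a| * (D + r * D)) hδ
    (f.continuous.comp hsc).measurable (by fun_prop) (by fun_prop) (by fun_prop)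
    (fun x y z => by
      simp only [hs]
      refine (hasDerivAt_comp_curve hfd
        (((hasDerivAt_id x).const_mul a).const_add p.1) (hasDerivAt_const x _)
        ((((((hasDerivAt_id x).const_mul Y).const_sub (X * y)).div_const 2).const_add
          (β * z)).const_mul a |>.const_add p.2.2)).congr_deriv ?_
      rw [fderiv_apply_eq hfd]
      simp only [id]
      ring)
    (fun x y z => by
      simp only [hs]
      refine (hasDerivAt_comp_curve hfd
        (hasDerivAt_const y _) (((hasDerivAt_id y).const_mul a).const_add p.2.1)
        ((((((hasDerivAt_id y).const_mul X).sub_const (Y * x)).div_const 2).const_add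
          (β * z)).const_mul a |>.const_add p.2.2)).congr_deriv ?_
      rw [fderiv_apply_eq hfd]
      simp only [id]
      ring)
    (fun x y z => by
      simp only [hs]
      refine (hasDerivAt_comp_curve hfd
        (hasDerivAt_const z _) (hasDerivAt_const z _)
        ((((hasDerivAt_id z).const_mul β).add_const ((X * y - Y * x) / 2)).const_mul a
          |>.const_add p.2.2)).congr_deriv ?_
      rw [fderiv_apply_eq hfd]
      simp only [id]
      ring)
    (fun _ => hC _) (fun _ => hbound _ (hxD _) (hzD _) _ hY)
    (fun _ => hbound _ (hyD _) (hzD _) _ hX)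
    (fun _ => hbound _ (by simpa using hD0) (hzD _) _ hβ)
  refine key.trans_eq (integral_congr_ae (ae_of_all _ fun t => ?_))
  simp only [hfun]
  ring

lemma eps_self {n : ℕ} (i : Fin n) : eps i i = 0 := by simp [eps]

lemma Xni_update (n : ℕ) (i : Fin n) (v : Fin n → H) (t : H) :
    Xni n i (Function.update v i t) = Xni n i v := by
  unfold Xni
  congr 1
  refine Finset.sum_congr rfl fun j _ => ?_
  rcases eq_or_ne j i with rfl | h
  · simp [eps_self]
  · simp [h]

lemma Yni_update (n : ℕ) (i : Fin n) (v : Fin n → H) (t : H) :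
    Yni n i (Function.update v i t) = Yni n i v := by
  unfold Yni
  congr 1
  refine Finset.sum_congr rfl fun j _ => ?_
  rcases eq_or_ne j i with rfl | h
  · simp [eps_self]
  · simp [h]

lemma sum_area_update {n : ℕ} (v : Fin n → H) (i : Fin n) (hi : v i = 0) (t : H) :
    ∑ j, ∑ k, (if j < k then (Function.update v i t j).1 * (Function.update v i t k).2.1
        - (Function.update v i t j).2.1 * (Function.update v i t k).1 else 0)
      = ∑ j, ∑ k, (if j < k then (v j).1 * (v k).2.1 - (v j).2.1 * (v k).1 else 0)
        + (t.1 * ∑ k, eps i k * (v k).2.1 - t.2.1 * ∑ k, eps i k * (v k).1) := by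
  have hterm : ∀ j k, (if j < k then (Function.update v i t j).1 * (Function.update v i t k).2.1
        - (Function.update v i t j).2.1 * (Function.update v i t k).1 else 0)
      = (if j < k then (v j).1 * (v k).2.1 - (v j).2.1 * (v k).1 else 0)
        + (if j = i then (if i < k then t.1 * (v k).2.1 - t.2.1 * (v k).1 else 0) else 0)
        + (if k = i then (if j < i then (v j).1 * t.2.1 - (v j).2.1 * t.1 else 0) else 0) := by
    intro j k
    rcases eq_or_ne j i with rfl | hj <;> rcases eq_or_ne k j with rfl | hk
    · simp
    · simp [hk, hi]
    · simp [hj]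
    · rcases eq_or_ne k i with rfl | hki
      · simp [hj, hi]
      · simp [hj, hki]
  have hinner : ∀ j, ∑ k, (if j = i then (if i < k then t.1 * (v k).2.1 - t.2.1 * (v k).1 else 0)
      else 0) = if j = i then ∑ k, (if i < k then t.1 * (v k).2.1 - t.2.1 * (v k).1 else 0)
      else 0 := fun j => by split_ifs <;> simp
  simp_rw [hterm, Finset.sum_add_distrib, hinner, Finset.sum_ite_eq', Finset.mem_univ, if_true]
  rw [add_assoc, ← Finset.sum_add_distrib, Finset.mul_sum, Finset.mul_sum,
    ← Finset.sum_sub_distrib]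
  congr 1
  refine Finset.sum_congr rfl fun k _ => ?_
  unfold eps
  rcases lt_trichotomy i k with h | rfl | h
  · simp [h, h.not_gt]
  · simp
  · simp [h, h.not_gt]
    ring

lemma sum_update_eq {n : ℕ} (v : Fin n → H) (i : Fin n) (t : H) (g : H → ℝ) (hg : g 0 = 0) :
    ∑ j, g (Function.update v i t j) = ∑ j, g (Function.update v i 0 j) + g t := by
  have : ∀ j, g (Function.update v i t j)
      = g (Function.update v i 0 j) + if j = i then g t else 0 := fun j => by
    rcases eq_or_ne j i with rfl | h
    · simp [hg]
    · simp [h]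
  simp [this, Finset.sum_add_distrib]

lemma rpow_neg_half_mul_self {n : ℕ} (hn : 1 ≤ n) :
    (n : ℝ) ^ (-(1 : ℝ) / 2) * (n : ℝ) ^ (-(1 : ℝ) / 2) = (n : ℝ)⁻¹ := by
  rw [← Real.rpow_add (by exact_mod_cast hn), ← Real.rpow_neg_one]
  norm_num

/-- The endpoint of the walk as a function of its `i`-th increment. -/
lemma snk_update (β : ℝ) {n : ℕ} (hn : 1 ≤ n) (v : Fin n → H) (i : Fin n) (t : H) :
    snk β n n (Function.update v i t)
      = ((snk β n n (Function.update v i 0)).1 + (n : ℝ) ^ (-(1 : ℝ) / 2) * t.1,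
        (snk β n n (Function.update v i 0)).2.1 + (n : ℝ) ^ (-(1 : ℝ) / 2) * t.2.1,
        (snk β n n (Function.update v i 0)).2.2 + (n : ℝ) ^ (-(1 : ℝ) / 2) *
          (β * t.2.2 + (Xni n i v * t.2.1 - Yni n i v * t.1) / 2)) := by
  have hupd : Function.update v i t = Function.update (Function.update v i 0) i t := by simp
  have harea := sum_area_update (Function.update v i 0) i (by simp) t
  rw [← hupd] at harea
  rw [← Xni_update n i v 0, ← Yni_update n i v 0]
  simp only [snk, Xni, Yni, Fin.is_lt, and_true, if_true, Fin.val_fin_lt]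
  rw [harea, sum_update_eq v i t (fun p => p.1) rfl, sum_update_eq v i t (fun p => p.2.1) rfl,
    sum_update_eq v i t (fun p => p.2.2) rfl]
  refine Prod.ext ?_ (Prod.ext ?_ ?_)
  · simp only; ring
  · simp only; ring
  · simp only [mul_inv]
    rw [← rpow_neg_half_mul_self hn]
    ring

lemma continuous_snk (β : ℝ) (n : ℕ) : Continuous (snk β n n) := by
  unfold snk
  simp only [Fin.is_lt, and_true, if_true]
  refine .prodMk (by fun_prop) (.prodMk (by fun_prop) (.add (by fun_prop) (.mul (by fun_prop) ?_)))
  refine continuous_finsetSum _ fun i _ => continuous_finsetSum _ fun j _ => ?_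
  split_ifs <;> fun_prop

lemma continuous_Xni (n : ℕ) (i : Fin n) : Continuous (Xni n i) := by
  unfold Xni
  fun_prop

lemma continuous_Yni (n : ℕ) (i : Fin n) : Continuous (Yni n i) := by
  unfold Yni
  fun_prop

lemma integrable_sq_sum_gaussN {n : ℕ} (c : ℝ) (e : Fin n → ℝ) {g : H → ℝ}
    (hg : MeasurePreserving g stdGauss3 (gaussianReal 0 1)) :
    Integrable (fun v => (c * ∑ j, e j * g (v j)) ^ 2) (gaussN n) := by
  have h : ∀ j ∈ Finset.univ, MemLp (fun v : Fin n → H => e j * g (v j)) 2 (gaussN n) := fun j _ =>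
    MemLp.const_mul ((memLp_id_gaussianReal' (μ := 0) (v := 1) 2 (by simp)).comp_measurePreserving
      (hg.comp (measurePreserving_eval (fun _ : Fin n => stdGauss3) j))) (e j)
  exact ((memLp_finsetSum _ h).const_mul c).integrable_sq

lemma integrable_Xni_sq (n : ℕ) (i : Fin n) :
    Integrable (fun v => Xni n i v ^ 2) (gaussN n) :=
  integrable_sq_sum_gaussN _ _ measurePreserving_fst

lemma integrable_Yni_sq (n : ℕ) (i : Fin n) :
    Integrable (fun v => Yni n i v ^ 2) (gaussN n) :=
  integrable_sq_sum_gaussN (g := fun p => p.2.1) _ _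
    ((measurePreserving_fst (μ := gaussianReal 0 1) (ν := gaussianReal 0 1)).comp
      (measurePreserving_snd (μ := gaussianReal 0 1)))

lemma abs_hfun_le {f : H → ℝ} {D : ℝ} (hxD : ∀ p, |pdx f p| ≤ D) (hyD : ∀ p, |pdy f p| ≤ D)
    (hzD : ∀ p, |pdz f p| ≤ D) (β : ℝ) (p : H) (w : ℝ × ℝ) :
    |hfun β f p w| ≤ (4 + β ^ 2) * D ^ 2 + D ^ 2 * (w.1 ^ 2 + w.2 ^ 2) := by
  have hx := sq_le_sq' (abs_le.1 (hxD p)).1 (abs_le.1 (hxD p)).2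
  have hy := sq_le_sq' (abs_le.1 (hyD p)).1 (abs_le.1 (hyD p)).2
  have hz := sq_le_sq' (abs_le.1 (hzD p)).1 (abs_le.1 (hzD p)).2
  unfold hfun
  rw [abs_of_nonneg (by positivity)]
  have h1 := sq_nonneg (pdx f p + w.2 / 2 * pdz f p)
  have h2 := sq_nonneg (pdy f p - w.1 / 2 * pdz f p)
  have h3 := mul_le_mul_of_nonneg_left hz (sq_nonneg w.1)
  have h4 := mul_le_mul_of_nonneg_left hz (sq_nonneg w.2)
  have h5 := mul_le_mul_of_nonneg_left hz (sq_nonneg β)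
  have h6 := mul_nonneg (sq_nonneg w.1) (sq_nonneg D)
  have h7 := mul_nonneg (sq_nonneg w.2) (sq_nonneg D)
  linarith

lemma integrable_hfun {f : H → ℝ} {D : ℝ} (hxD : ∀ p, |pdx f p| ≤ D) (hyD : ∀ p, |pdy f p| ≤ D)
    (hzD : ∀ p, |pdz f p| ≤ D) (hxc : Continuous (pdx f)) (hyc : Continuous (pdy f))
    (hzc : Continuous (pdz f)) (β : ℝ) (n : ℕ) (i : Fin n) :
    Integrable (fun v => hfun β f (snk β n n v) (Xni n i v, Yni n i v)) (gaussN n) := by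
  have hs := continuous_snk β n
  have hX := continuous_Xni n i
  have hY := continuous_Yni n i
  refine Integrable.mono' ((integrable_const ((4 + β ^ 2) * D ^ 2)).add
    (((integrable_Xni_sq n i).add (integrable_Yni_sq n i)).const_mul (D ^ 2)))
    (Continuous.aestronglyMeasurable ?_)
    (ae_of_all _ fun v => abs_hfun_le hxD hyD hzD β _ _)
  unfold hfun
  fun_prop

/-- Entropy of a bounded function is the limit of the entropies of its upward translates. -/
lemma tendsto_ent_add_const {α : Type*} [MeasurableSpace α] {μ : Measure α}
    [IsProbabilityMeasure μ] {F : α → ℝ} (hF : Measurable F) {C : ℝ} (h0 : ∀ a, 0 ≤ F a)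
    (hC : ∀ a, F a ≤ C) :
    Tendsto (fun δ => Ent μ fun a => F a + δ) (𝓝[>] 0) (𝓝 (Ent μ F)) := by
  obtain ⟨K, hK⟩ := (isCompact_Icc (a := (0 : ℝ)) (b := C + 1)).exists_bound_of_continuousOn
    Real.continuous_mul_log.continuousOn
  have hmem : ∀ᶠ δ : ℝ in 𝓝[>] 0, δ ∈ Ioo (0 : ℝ) 1 := Ioo_mem_nhdsGT one_pos
  have hid : Tendsto (fun δ : ℝ => δ) (𝓝[>] 0) (𝓝 0) := tendsto_id.mono_left nhdsWithin_le_nhds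
  have hlim : ∀ a, Tendsto (fun δ => F a + δ) (𝓝[>] 0) (𝓝 (F a)) := fun a => by
    simpa using hid.const_add (F a)
  have h1 : Tendsto (fun δ => ∫ a, (F a + δ) * Real.log (F a + δ) ∂μ) (𝓝[>] 0)
      (𝓝 (∫ a, F a * Real.log (F a) ∂μ)) := by
    refine tendsto_integral_filter_of_dominated_convergence (fun _ => K)
      (.of_forall fun δ => (Real.continuous_mul_log.measurable.comp
        (hF.add_const δ)).aestronglyMeasurable) ?_ (integrable_const K)
      (ae_of_all _ fun a => (Real.continuous_mul_log.tendsto (F a)).comp (hlim a))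
    filter_upwards [hmem] with δ hδ
    exact ae_of_all _ fun a => hK _ ⟨by linarith [h0 a, hδ.1], by linarith [hC a, hδ.2]⟩
  have h2 : Tendsto (fun δ => ∫ a, (F a + δ) ∂μ) (𝓝[>] 0) (𝓝 (∫ a, F a ∂μ)) := by
    have hFi : Integrable F μ := integrable_of_abs_le (C := C) hF fun a => by
      rw [abs_of_nonneg (h0 a)]
      exact hC a
    have : ∀ δ, ∫ a, (F a + δ) ∂μ = ∫ a, F a ∂μ + δ := fun δ => by
      rw [integral_add hFi (integrable_const δ)]
      simp
    simp_rw [this]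
    simpa using hid.const_add (∫ a, F a ∂μ)
  exact h1.sub ((Real.continuous_mul_log.tendsto _).comp h2)

lemma SchwartzMap.exists_abs_pd_le (f : SchwartzMap H ℝ) :
    ∃ D, (∀ p, |pdx f p| ≤ D) ∧ (∀ p, |pdy f p| ≤ D) ∧ ∀ p, |pdz f p| ≤ D := by
  have hf : Differentiable ℝ f := f.differentiable
  have hb : ∀ p (w : H), ‖w‖ ≤ 1 → |fderiv ℝ f p w|
      ≤ SchwartzMap.seminorm ℝ 0 0 (SchwartzMap.fderivCLM ℝ H ℝ f) := fun p w hw => by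
    have h := SchwartzMap.norm_le_seminorm ℝ (SchwartzMap.fderivCLM ℝ H ℝ f) p
    rw [SchwartzMap.fderivCLM_apply] at h
    exact ((fderiv ℝ f p).le_of_opNorm_le_of_le h hw).trans_eq (mul_one _)
  refine ⟨SchwartzMap.seminorm ℝ 0 0 (SchwartzMap.fderivCLM ℝ H ℝ f),
    fun p => ?_, fun p => ?_, fun p => ?_⟩
  · rw [pdx_eq hf]; exact hb p _ (by simp [Prod.norm_def])
  · rw [pdy_eq hf]; exact hb p _ (by simp [Prod.norm_def])
  · rw [pdz_eq hf]; exact hb p _ (by simp [Prod.norm_def])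

lemma SchwartzMap.continuous_pd (f : SchwartzMap H ℝ) :
    Continuous (pdx f) ∧ Continuous (pdy f) ∧ Continuous (pdz f) := by
  have hf : Differentiable ℝ f := f.differentiable
  have hc : Continuous (fderiv ℝ f) := (f.smooth 1).continuous_fderiv one_ne_zero
  rw [show pdx f = _ from funext (pdx_eq hf), show pdy f = _ from funext (pdy_eq hf),
    show pdz f = _ from funext (pdz_eq hf)]
  exact ⟨by fun_prop, by fun_prop, by fun_prop⟩

lemma ent_nuMeas (β : ℝ) (n : ℕ) {F : H → ℝ} (hF : Measurable F) :
    Ent (nuMeas β n) F = Ent (gaussN n) fun v => F (snk β n n v) := by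
  have hs := (continuous_snk β n).measurable.aemeasurable (μ := gaussN n)
  have hlog : Measurable fun p => F p * Real.log (F p) :=
    Real.continuous_mul_log.measurable.comp hF
  rw [Ent, Ent, nuMeas, integral_map hs hF.aestronglyMeasurable,
    integral_map hs hlog.aestronglyMeasurable]

theorem finite_n_lsi (β : ℝ) (hβ : 0 ≤ β) (n : ℕ) (hn : 1 ≤ n)
    (f : SchwartzMap H ℝ) :
    Ent (nuMeas β n) (fun h => f h ^ 2) ≤
      (2 / (n : ℝ)) * ∑ i : Fin n,
        ∫ v, hfun β f (snk β n n v) (Xni n i v, Yni n i v) ∂(gaussN n) := by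
  obtain ⟨D, hxD, hyD, hzD⟩ := f.exists_abs_pd_le
  obtain ⟨hxc, hyc, hzc⟩ := f.continuous_pd
  have hC : ∀ p, |f p| ≤ SchwartzMap.seminorm ℝ 0 0 f := fun p => f.norm_le_seminorm ℝ p
  set C := SchwartzMap.seminorm ℝ 0 0 f
  have hC2 : ∀ p, f p ^ 2 ≤ C ^ 2 := fun p => sq_le_sq' (abs_le.1 (hC p)).1 (abs_le.1 (hC p)).2
  have hm : Measurable fun v => f (snk β n n v) ^ 2 :=
    ((f.continuous.comp (continuous_snk β n)).pow 2).measurable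
  rw [ent_nuMeas β n (F := fun p => f p ^ 2) (f.continuous.pow 2).measurable]
  refine le_of_tendsto (tendsto_ent_add_const hm (fun v => sq_nonneg _) fun v => hC2 _) ?_
  filter_upwards [self_mem_nhdsWithin] with δ hδ
  have key := ent_pi_le (μ := stdGauss3) (c := δ) (C := C ^ 2 + δ) hδ n
    (D := fun i v => 2 * ((n : ℝ) ^ (-(1 : ℝ) / 2)) ^ 2 *
      hfun β f (snk β n n v) (Xni n i v, Yni n i v)) (hm.add_const δ)
    (fun v => by linarith [sq_nonneg (f (snk β n n v))])
    (fun v => by linarith [hC2 (snk β n n v)])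
    (fun i => (integrable_hfun hxD hyD hzD hxc hyc hzc β n i).const_mul _)
    (fun i v => by
      simp only [Xni_update, Yni_update]
      exact ent_stdGauss3_translate_le f hδ hC hxD hyD hzD hxc hyc hzc β _ _ _ _
        fun t => snk_update β hn v i t)
  refine key.trans_eq ?_
  rw [Finset.mul_sum]
  refine Finset.sum_congr rfl fun i _ => ?_
  rw [integral_const_mul, sq, rpow_neg_half_mul_self hn, div_eq_mul_inv]
  rfl

end
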